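/- arXiv:2605.13657 — 2 statements merged into one kernel-verified Lean document; each statement's English description precedes it below -/
import Mathlib

section
/- Let φ and s be n×n complex matrices with φ·s = s·φ. Then ⟨⁅⁅φ, φᴴ⁆, s⁆, s⟩ = ⟨⁅φᴴ, s⁆, ⁅φᴴ, s⁆⟩, i.e. trace(⁅⁅φ, φᴴ⁆, s⁆ · sᴴ) equals trace(⁅φᴴ, s⁆ · ⁅φᴴ, s⁆ᴴ), the squared Frobenius norm of ⁅φᴴ, s⁆; in particular this quantity is a nonnegative real number. -/
open Matrix

open scoped ComplexOrder

/-- Invariance of the trace form under the commutator. -/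
theorem Matrix.trace_commutator_mul {n R : Type*} [Fintype n] [CommRing R]
    (A X Y : Matrix n n R) : (⁅A, X⁆ * Y).trace = (X * ⁅Y, A⁆).trace := by
  simp only [Ring.lie_def, sub_mul, mul_sub, trace_sub, mul_assoc]
  rw [trace_mul_comm A, mul_assoc]

/-- Let `φ` and `s` be `n × n` complex matrices with `φ * s = s * φ`. Then
`⟨⁅⁅φ, φᴴ⁆, s⁆, s⟩ = ⟨⁅φᴴ, s⁆, ⁅φᴴ, s⁆⟩` for the Frobenius inner product
`⟨X, Y⟩ := trace (X * Yᴴ)`, i.e. `trace (⁅⁅φ, φᴴ⁆, s⁆ * sᴴ)` equals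
`trace (⁅φᴴ, s⁆ * ⁅φᴴ, s⁆ᴴ)`, the squared Frobenius norm of `⁅φᴴ, s⁆`; in
particular this quantity is a nonnegative real number. -/
theorem frobenius_curvature_term_eq_sq_norm {n : Type*} [Fintype n] [DecidableEq n]
    (φ s : Matrix n n ℂ) (h : φ * s = s * φ) :
    (⁅⁅φ, φᴴ⁆, s⁆ * sᴴ).trace = (⁅φᴴ, s⁆ * ⁅φᴴ, s⁆ᴴ).trace ∧
      ∃ r : ℝ, 0 ≤ r ∧ (⁅⁅φ, φᴴ⁆, s⁆ * sᴴ).trace = (r : ℂ) := by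
  have key : (⁅⁅φ, φᴴ⁆, s⁆ * sᴴ).trace = (⁅φᴴ, s⁆ * ⁅φᴴ, s⁆ᴴ).trace := by
    have hφs : ⁅φ, s⁆ = 0 := by rw [Ring.lie_def, h, sub_self]
    have hstar : ⁅φᴴ, s⁆ᴴ = ⁅sᴴ, φ⁆ := by simp [Ring.lie_def]
    have jacobi : ⁅⁅φ, φᴴ⁆, s⁆ = ⁅φ, ⁅φᴴ, s⁆⁆ - ⁅φᴴ, ⁅φ, s⁆⁆ := by
      simp only [Ring.lie_def]
      noncomm_ring
    rw [jacobi, hφs, Ring.lie_def φᴴ 0, mul_zero, zero_mul, sub_zero, sub_zero,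
      trace_commutator_mul, hstar]
  refine ⟨key, ?_⟩
  rw [key]
  obtain ⟨r, hr, hr_eq⟩ := RCLike.nonneg_iff_exists_ofReal.mp
    (posSemidef_self_mul_conjTranspose ⁅φᴴ, s⁆).trace_nonneg
  exact ⟨r, hr, hr_eq.symm⟩
end

section
/- Let φ and s be n×n complex matrices with φ·s = s·φ. If trace(⁅⁅φ, φᴴ⁆, s⁆ · sᴴ) = 0, then ⁅φᴴ, s⁆ = 0. -/
open Matrix

/-- If `φ` and `s` commute, then pairing `⁅⁅φ, φᴴ⁆, s⁆` with `s` gives the squared Frobenius norm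
of `⁅φᴴ, s⁆`. -/
theorem trace_lie_lie_conjTranspose_mul_conjTranspose {n : Type*} [Fintype n]
    {R : Type*} [CommRing R] [StarRing R] {φ s : Matrix n n R} (h : φ * s = s * φ) :
    (⁅⁅φ, φᴴ⁆, s⁆ * sᴴ).trace = (⁅φᴴ, s⁆ * ⁅φᴴ, s⁆ᴴ).trace := by
  have jacobi : ⁅⁅φ, φᴴ⁆, s⁆ = ⁅φ, ⁅φᴴ, s⁆⁆ := by
    simp only [Ring.lie_def, mul_sub, sub_mul, mul_assoc, h]
    simp only [← mul_assoc, h]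
    abel
  have adjoint : ⁅φᴴ, s⁆ᴴ = sᴴ * φ - φ * sᴴ := by
    simp [Ring.lie_def]
  rw [jacobi, adjoint, Ring.lie_def φ, sub_mul, mul_sub, trace_sub, trace_sub, mul_assoc φ,
    trace_mul_comm φ, mul_assoc, mul_assoc]

/-- Let `φ` and `s` be `n × n` complex matrices with `φ * s = s * φ`. If
`trace (⁅⁅φ, φᴴ⁆, s⁆ * sᴴ) = 0`, then `⁅φᴴ, s⁆ = 0`. -/
theorem commutator_conjTranspose_eq_zero_of_trace_eq_zero
    {n : Type*} [Fintype n] [DecidableEq n]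
    (φ s : Matrix n n ℂ) (h : φ * s = s * φ)
    (h0 : (⁅⁅φ, φᴴ⁆, s⁆ * sᴴ).trace = 0) :
    ⁅φᴴ, s⁆ = 0 := by
  open scoped ComplexOrder in
  rwa [trace_lie_lie_conjTranspose_mul_conjTranspose h,
    trace_mul_conjTranspose_self_eq_zero_iff] at h0
end
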